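/- arXiv:math/0309381 — 10 statements merged into one kernel-verified Lean document; each statement's English description precedes it below -/
import Mathlib

section
/- For every integer g ≥ 2, the consistency equation (cos γ_g · cos α_g + cos β_g)/(sin γ_g · sin α_g) = (cos δ_g · cos α_g + cos α_g)/(sin δ_g · sin α_g) holds. (This is the condition ensuring that the partially truncated tetrahedra of the triangulation T_g of M_g glue by isometries, giving a hyperbolic structure.) -/
open Real

/-- For every integer `g ≥ 2`, the consistency equation ensuring that the partially
truncated tetrahedra of the triangulation `T_g` of `M_g` glue by isometries holds. -/
theorem consistency_equation (g : ℕ) (hg : 2 ≤ g) (α β γ δ : ℝ)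
    (hα : α = π / (2 * (g : ℝ) + 2)) (hβ : β = 2 * α)
    (hγ : γ = arccos (1 / (2 * cos α))) (hδ : δ = π - 2 * γ) :
    (cos γ * cos α + cos β) / (sin γ * sin α) =
      (cos δ * cos α + cos α) / (sin δ * sin α) := by
  have hg' : (2 : ℝ) ≤ (g : ℝ) := by exact_mod_cast hg
  have hpi := Real.pi_pos
  have hα0 : 0 < α := by rw [hα]; positivity
  have hα1 : α < π / 3 := by
    rw [hα]
    exact div_lt_div_of_pos_left hpi (by norm_num) (by linarith)
  have hc : 1 / 2 < cos α := by
    rw [← Real.cos_pi_div_three]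
    exact Real.cos_lt_cos_of_nonneg_of_le_pi hα0.le (by linarith) hα1
  have hs : 0 < sin α := Real.sin_pos_of_pos_of_lt_pi hα0 (by linarith)
  have hc0 : 0 < cos α := by linarith
  have hx0 : 0 < 1 / (2 * cos α) := by positivity
  have hx1 : 1 / (2 * cos α) < 1 := by
    rw [div_lt_one (by positivity)]; linarith
  have hcγ : cos γ = 1 / (2 * cos α) := by
    rw [hγ]; exact Real.cos_arccos (by linarith) hx1.le
  have hsq : sin γ ^ 2 = 1 - (1 / (2 * cos α)) ^ 2 := by
    rw [← hcγ]; exact Real.sin_sq γ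
  have hsγ : sin γ ≠ 0 := by
    intro h
    rw [h] at hsq
    nlinarith
  have hcδ : cos δ = 1 - 2 * (1 / (2 * cos α)) ^ 2 := by
    rw [hδ, Real.cos_pi_sub, Real.cos_two_mul, hcγ]; ring
  have hsδ : sin δ = 2 * sin γ * (1 / (2 * cos α)) := by
    rw [hδ, Real.sin_pi_sub, Real.sin_two_mul, hcγ]
  have hsδ0 : sin δ ≠ 0 := by
    rw [hsδ]; exact mul_ne_zero (mul_ne_zero two_ne_zero hsγ) hx0.ne'
  rw [div_eq_div_iff (mul_ne_zero hsγ hs.ne') (mul_ne_zero hsδ0 hs.ne'),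
    hsδ, hcδ, hβ, Real.cos_two_mul, hcγ]
  field_simp
  ring
end

section
/- For every integer g ≥ 2, the quantity d₄(g) = 2·cos²α_g + cos²δ_g + 2·cos²α_g·cos δ_g − 1 is strictly positive. -/
open Real

/-- For every integer `g ≥ 2`, the quantity
`d₄(g) = 2 cos²α_g + cos²δ_g + 2 cos²α_g cos δ_g − 1` is strictly positive. -/
theorem d4_pos (g : ℕ) (hg : 2 ≤ g) (α β γ δ : ℝ)
    (hα : α = π / (2 * (g : ℝ) + 2)) (hβ : β = 2 * α)
    (hγ : γ = arccos (1 / (2 * cos α))) (hδ : δ = π - 2 * γ) :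
    0 < 2 * cos α ^ 2 + cos δ ^ 2 + 2 * cos α ^ 2 * cos δ - 1 := by
  have hg' : (2 : ℝ) ≤ g := by exact_mod_cast hg
  have hα0 : 0 ≤ α := by rw [hα]; positivity
  have hα6 : α ≤ π / 6 := by
    rw [hα]
    exact div_le_div_of_nonneg_left pi_pos.le (by norm_num) (by linarith)
  have hc : √3 / 2 ≤ cos α := by
    rw [← cos_pi_div_six]
    exact cos_le_cos_of_nonneg_of_le_pi hα0 (by linarith [pi_pos]) hα6
  have h3 : √3 ^ 2 = 3 := sq_sqrt (by norm_num)
  have h30 : 1 < √3 := by rw [lt_sqrt] <;> norm_num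
  have hx : 3 / 4 ≤ cos α ^ 2 := by nlinarith
  have hpos : 0 < cos α := by linarith
  have hle : 1 / (2 * cos α) ≤ 1 := by
    rw [div_le_one (by linarith)]; linarith
  have hge : 0 ≤ 1 / (2 * cos α) := by positivity
  have hcg : cos γ = 1 / (2 * cos α) := by
    rw [hγ, cos_arccos (by linarith) hle]
  have hd : cos δ = 1 - 2 * (1 / (2 * cos α)) ^ 2 := by
    rw [hδ, cos_pi_sub, cos_two_mul, hcg]; ring
  have hm : 2 * cos α ^ 2 * cos δ = 2 * cos α ^ 2 - 1 := by
    rw [hd]; field_simp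
  nlinarith [sq_nonneg (cos δ)]
end

section
/- For every integer g ≥ 2, one has √(d₄(g)) = 2·√(d₂(g))·cos γ_g, i.e. d₄(g) = 4·d₂(g)·cos²γ_g. (This is one of the two vanishing identities −2√(d₂)·cos γ_g + √(d₄) = 0 used to show that all tilts of the triangulation T_g are negative.) -/
open Real

/-- For every integer `g ≥ 2`, one has `√(d₄(g)) = 2 √(d₂(g)) cos γ_g`, i.e.
`d₄(g) = 4 d₂(g) cos²γ_g`. -/
theorem sqrt_d4_eq (g : ℕ) (hg : 2 ≤ g) (α β γ δ d₂ d₄ : ℝ)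
    (hα : α = π / (2 * (g : ℝ) + 2)) (hβ : β = 2 * α)
    (hγ : γ = arccos (1 / (2 * cos α))) (hδ : δ = π - 2 * γ)
    (hd₂ : d₂ = cos α ^ 2 + cos β ^ 2 + cos γ ^ 2 + 2 * cos α * cos β * cos γ - 1)
    (hd₄ : d₄ = 2 * cos α ^ 2 + cos δ ^ 2 + 2 * cos α ^ 2 * cos δ - 1) :
    Real.sqrt d₄ = 2 * Real.sqrt d₂ * cos γ ∧ d₄ = 4 * d₂ * cos γ ^ 2 := by
  have hg' : (2 : ℝ) ≤ g := by exact_mod_cast hg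
  have hα0 : 0 ≤ α := by rw [hα]; positivity
  have hα1 : α ≤ π / 3 := by
    rw [hα]
    exact div_le_div_of_nonneg_left pi_pos.le (by norm_num) (by linarith)
  have hc : 1 / 2 ≤ cos α := by
    rw [← cos_pi_div_three]
    exact cos_le_cos_of_nonneg_of_le_pi hα0 (by linarith [pi_pos]) hα1
  have hcpos : 0 < cos α := by linarith
  have hk0 : 0 ≤ 1 / (2 * cos α) := by positivity
  have hk1 : 1 / (2 * cos α) ≤ 1 := by
    rw [div_le_one (by positivity)]; linarith
  have hk : cos γ = 1 / (2 * cos α) := by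
    rw [hγ, cos_arccos (by linarith) hk1]
  have hkey : d₄ = 4 * d₂ * cos γ ^ 2 := by
    rw [hd₄, hd₂, hδ, hβ, cos_pi_sub, cos_two_mul, cos_two_mul, hk]
    field_simp
    ring
  refine ⟨?_, hkey⟩
  have hkn : 0 ≤ 2 * cos γ := by rw [hk]; positivity
  have h2 : d₄ = d₂ * (2 * cos γ) ^ 2 := by rw [hkey]; ring
  rw [h2, Real.sqrt_mul' _ (sq_nonneg _), Real.sqrt_sq hkn]
  ring
end

section
/- For every integer g ≥ 2, one has √(d₂(g))·(1 − cos δ_g) − √(d₄(g))·cos γ_g = 0. (This is the other vanishing identity used to show that all tilts of the triangulation T_g are negative.) -/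
open Real

/-- For every integer `g ≥ 2`, one has `√(d₂(g))·(1 − cos δ_g) − √(d₄(g))·cos γ_g = 0`. -/
theorem tilt_vanishing (g : ℕ) (hg : 2 ≤ g) (α β γ δ d₂ d₄ : ℝ)
    (hα : α = π / (2 * (g : ℝ) + 2)) (hβ : β = 2 * α)
    (hγ : γ = arccos (1 / (2 * cos α))) (hδ : δ = π - 2 * γ)
    (hd₂ : d₂ = cos α ^ 2 + cos β ^ 2 + cos γ ^ 2 + 2 * cos α * cos β * cos γ - 1)
    (hd₄ : d₄ = 2 * cos α ^ 2 + cos δ ^ 2 + 2 * cos α ^ 2 * cos δ - 1) :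
    Real.sqrt d₂ * (1 - cos δ) - Real.sqrt d₄ * cos γ = 0 := by
  have hg' : (2 : ℝ) ≤ g := by exact_mod_cast hg
  have hα0 : 0 ≤ α := by rw [hα]; positivity
  have hα3 : α ≤ π / 3 := by
    rw [hα]
    exact div_le_div_of_nonneg_left pi_pos.le (by norm_num) (by linarith)
  have hc : 1 / 2 ≤ cos α := by
    rw [← cos_pi_div_three]
    exact cos_le_cos_of_nonneg_of_le_pi hα0 (by linarith [pi_pos]) hα3
  have hc0 : 0 < cos α := by linarith
  have hk : cos γ = 1 / (2 * cos α) := by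
    rw [hγ]
    apply cos_arccos
    · have : 0 < 1 / (2 * cos α) := by positivity
      linarith
    · rw [div_le_one (by positivity)]; linarith
  have hk0 : 0 < cos γ := by rw [hk]; positivity
  have hdel : cos δ = 1 - 2 * cos γ ^ 2 := by
    rw [hδ, cos_pi_sub, cos_two_mul]; ring
  have hb : cos β = 2 * cos α ^ 2 - 1 := by rw [hβ, cos_two_mul]
  have key : d₄ = (2 * cos γ) ^ 2 * d₂ := by
    rw [hd₄, hd₂, hdel, hb, hk]
    field_simp
    ring
  have hs : Real.sqrt d₄ = 2 * cos γ * Real.sqrt d₂ := by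
    rw [key, Real.sqrt_mul (by positivity), Real.sqrt_sq (by positivity)]
  rw [hs, hdel]
  ring
end

section
/- For every integer g ≥ 2 and every real constant k > 0, there exists r₀ > 0 such that for all r with 0 < r < r₀, setting d₁ = 2r·(sin²γ_g·sin δ_g)/(2·sin γ_g·cos α_g + sin δ_g·cos β_g), all three of the following tilt expressions are strictly negative: d₁ − k·(2·√(d₂(g))·cos α_g + √(d₄(g))·cos β_g); −d₁·cos α_g + k·(√(d₂(g))·(1 − cos δ_g) − √(d₄(g))·cos γ_g); and −d₁·cos β_g + k·(−2·√(d₂(g))·cos γ_g + √(d₄(g))). (This is the computation showing that the triangulation T_g is the canonical Kojima decomposition of M_g.) -/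
open Real

/-- For every integer `g ≥ 2` and every constant `k > 0`, there exists `r₀ > 0`
such that for all `0 < r < r₀` all three tilt expressions of the triangulation
`T_g` are strictly negative (so `T_g` is the canonical Kojima decomposition of `M_g`). -/
theorem tilts_negative (g : ℕ) (hg : 2 ≤ g) (α β γ δ d₂ d₄ : ℝ)
    (hα : α = π / (2 * (g : ℝ) + 2)) (hβ : β = 2 * α)
    (hγ : γ = arccos (1 / (2 * cos α))) (hδ : δ = π - 2 * γ)
    (hd₂ : d₂ = cos α ^ 2 + cos β ^ 2 + cos γ ^ 2 + 2 * cos α * cos β * cos γ - 1)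
    (hd₄ : d₄ = 2 * cos α ^ 2 + cos δ ^ 2 + 2 * cos α ^ 2 * cos δ - 1)
    (k : ℝ) (hk : 0 < k) :
    ∃ r₀ > 0, ∀ r : ℝ, 0 < r → r < r₀ →
      ∀ d₁ : ℝ, d₁ = 2 * r * (sin γ ^ 2 * sin δ) / (2 * sin γ * cos α + sin δ * cos β) →
        d₁ - k * (2 * Real.sqrt d₂ * cos α + Real.sqrt d₄ * cos β) < 0 ∧
        -d₁ * cos α + k * (Real.sqrt d₂ * (1 - cos δ) - Real.sqrt d₄ * cos γ) < 0 ∧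
        -d₁ * cos β + k * (-2 * Real.sqrt d₂ * cos γ + Real.sqrt d₄) < 0 := by
  have hg' : (2:ℝ) ≤ g := by exact_mod_cast hg
  have hα0 : 0 < α := by rw [hα]; positivity
  have hα1 : α ≤ π / 6 := by
    rw [hα]
    exact div_le_div_of_nonneg_left pi_pos.le (by norm_num) (by linarith)
  have hc1 : √3 / 2 ≤ cos α := by
    rw [← cos_pi_div_six]
    exact cos_le_cos_of_nonneg_of_le_pi hα0.le (by linarith [pi_pos]) hα1
  have h3 : (0:ℝ) < √3 := by positivity
  have h3s : √3 ^ 2 = 3 := Real.sq_sqrt (by norm_num)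
  have hc0 : 0 < cos α := by linarith
  have hx : 3 / 4 ≤ cos α ^ 2 := by nlinarith
  have hcβ : cos β = 2 * cos α ^ 2 - 1 := by rw [hβ, cos_two_mul]
  have hβ0 : 0 < cos β := by rw [hcβ]; linarith
  have hc12 : 1 / 2 < cos α := by nlinarith
  have hy0 : 0 < 1 / (2 * cos α) := by positivity
  have hy1 : 1 / (2 * cos α) < 1 := by rw [div_lt_one (by positivity)]; linarith
  have hcγ : cos γ = 1 / (2 * cos α) := by
    rw [hγ, cos_arccos (by linarith) hy1.le]
  have hγ0 : 0 < γ := by rw [hγ]; exact arccos_pos.2 hy1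
  have hγ1 : γ < π / 2 := by rw [hγ]; exact arccos_lt_pi_div_two.2 hy0
  have hsγ : 0 < sin γ := sin_pos_of_pos_of_lt_pi hγ0 (by linarith [pi_pos])
  have hsδ : 0 < sin δ := sin_pos_of_pos_of_lt_pi (by linarith) (by linarith)
  have hcδ : cos δ = 1 - 2 * cos γ ^ 2 := by
    rw [hδ, cos_pi_sub, cos_two_mul]; ring
  have hcc : 2 * cos α * cos γ = 1 := by rw [hcγ]; field_simp
  have hcγ0 : 0 < cos γ := by rw [hcγ]; exact hy0
  have hd2 : 0 < d₂ := by
    have e : d₂ = 4 * (cos α ^ 2) ^ 2 - cos α ^ 2 - 1 + cos γ ^ 2 := by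
      rw [hd₂, hcβ]; linear_combination (2 * cos α ^ 2 - 1) * hcc
    rw [e]; nlinarith [sq_nonneg (cos γ)]
  have hd4 : d₄ = (2 * cos γ) ^ 2 * d₂ := by
    rw [hd₄, hd₂, hcδ, hcβ, hcγ]
    field_simp
    ring
  have hs4 : √d₄ = 2 * cos γ * √d₂ := by
    rw [hd4, Real.sqrt_mul (by positivity), Real.sqrt_sq (by positivity)]
  have hs2 : 0 < √d₂ := Real.sqrt_pos.2 hd2
  rw [hs4, hcδ]
  have hA : 0 < 2 * (sin γ ^ 2 * sin δ) / (2 * sin γ * cos α + sin δ * cos β) := by positivity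
  have hS : 0 < k * (2 * √d₂ * cos α + 2 * cos γ * √d₂ * cos β) := by positivity
  refine ⟨_, div_pos hS hA, fun r hr hr0 d₁ hd₁ => ?_⟩
  have hd₁' : d₁ = r * (2 * (sin γ ^ 2 * sin δ) / (2 * sin γ * cos α + sin δ * cos β)) := by
    rw [hd₁]; ring
  have hdpos : 0 < d₁ := by rw [hd₁']; exact mul_pos hr hA
  rw [lt_div_iff₀ hA, ← hd₁'] at hr0
  refine ⟨by linarith, ?_, ?_⟩
  · have := mul_pos hdpos hc0
    linear_combination this
  · have := mul_pos hdpos hβ0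
    linear_combination this
end

section
/- For every integer g ≥ 2, one has cos²α_g + cos²β_g + 2·cos²γ_g + 2·cos α_g·cos β_g·cos γ_g > 2. (This is the inequality equivalent to R' > R, where R' is the common Euclidean radius of the truncation circles S₂, S₃, S₄ and R is the radius of the trace circle F₁ in the upper half-space realization of a tetrahedron of T_g; it shows that the maximal horocusp section of M_g sits above the truncation planes.) -/
open Real

/-- For every integer `g ≥ 2`, one has
`cos²α_g + cos²β_g + 2 cos²γ_g + 2 cos α_g cos β_g cos γ_g > 2`,
the inequality equivalent to `R' > R` in Lemma 4.2. -/
theorem Rprime_gt_R (g : ℕ) (hg : 2 ≤ g) (α β γ : ℝ)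
    (hα : α = π / (2 * (g : ℝ) + 2)) (hβ : β = 2 * α)
    (hγ : γ = arccos (1 / (2 * cos α))) :
    2 < cos α ^ 2 + cos β ^ 2 + 2 * cos γ ^ 2 + 2 * cos α * cos β * cos γ := by
  have hg' : (2 : ℝ) ≤ g := by exact_mod_cast hg
  have hpi := Real.pi_pos
  have hα0 : 0 ≤ α := by rw [hα]; positivity
  have hα1 : α ≤ π / 6 := by
    rw [hα]
    apply div_le_div_of_nonneg_left hpi.le (by norm_num) (by linarith)
  have hc : √3 / 2 ≤ cos α := by
    rw [← Real.cos_pi_div_six]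
    exact Real.cos_le_cos_of_nonneg_of_le_pi hα0 (by linarith) hα1
  have h3 : √3 ^ 2 = 3 := Real.sq_sqrt (by norm_num)
  have h30 : 0 < √3 := by positivity
  have hc0 : 0 < cos α := by linarith
  have hx : 3 / 4 ≤ cos α ^ 2 := by nlinarith
  have hc2 : 1 / 2 ≤ cos α := by nlinarith
  have hcγ : cos γ = 1 / (2 * cos α) := by
    rw [hγ, Real.cos_arccos]
    · have : 0 ≤ 1 / (2 * cos α) := by positivity
      linarith
    · rw [div_le_one (by positivity)]; linarith
  have hcβ : cos β = 2 * cos α ^ 2 - 1 := by rw [hβ, Real.cos_two_mul]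
  rw [hcγ, hcβ]
  generalize cos α = c at *
  have key : c ^ 2 + (2 * c ^ 2 - 1) ^ 2 + 2 * (1 / (2 * c)) ^ 2
      + 2 * c * (2 * c ^ 2 - 1) * (1 / (2 * c)) - 2
      = (8 * (c ^ 2) ^ 3 - 2 * (c ^ 2) ^ 2 - 4 * c ^ 2 + 1) / (2 * c ^ 2) := by
    field_simp
    ring
  have hpos : 0 < 8 * (c ^ 2) ^ 3 - 2 * (c ^ 2) ^ 2 - 4 * c ^ 2 + 1 := by
    obtain ⟨t, ht⟩ : ∃ t, t = c ^ 2 - 3 / 4 := ⟨_, rfl⟩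
    have ht0 : 0 ≤ t := by linarith
    have hct : c ^ 2 = t + 3 / 4 := by linarith
    rw [hct]
    ring_nf
    positivity
  have := div_pos hpos (show 0 < 2 * c ^ 2 by positivity)
  linarith
end

section
/- Let α, β, γ, γ' be real numbers with 0 < γ' < π, sin γ ≠ 0 and cos β ≠ 0, satisfying cot γ' = (cos α + cos β·cos γ)/(cos β·sin γ). Let R > 0 and define AC = R·cos β/sin γ' and R'² = AC² − R². Then R'² = R²·(cos²α + cos²β + cos²γ + 2·cos α·cos β·cos γ − 1)/sin²γ. (This is equation (1) of Lemma 4.1, expressing the squared radius R'² of the truncation circles in terms of the dihedral angles.) -/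
open Real

/-- Equation (1) of Lemma 4.1: with `cot γ' = (cos α + cos β cos γ)/(cos β sin γ)`,
`AC = R cos β / sin γ'` and `R'² = AC² − R²`, one has
`R'² = R² (cos²α + cos²β + cos²γ + 2 cos α cos β cos γ − 1)/sin²γ`. -/
theorem radius_formula (α β γ γ' R AC Rsq' : ℝ) (h0 : 0 < γ') (h1 : γ' < π)
    (hγ : sin γ ≠ 0) (hβ : cos β ≠ 0)
    (hcot : Real.cot γ' = (cos α + cos β * cos γ) / (cos β * sin γ))
    (hR : 0 < R) (hAC : AC = R * cos β / sin γ') (hR' : Rsq' = AC ^ 2 - R ^ 2) :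
    Rsq' = R ^ 2 *
      (cos α ^ 2 + cos β ^ 2 + cos γ ^ 2 + 2 * cos α * cos β * cos γ - 1) / sin γ ^ 2 := by
  have hs : sin γ' ≠ 0 := (sin_pos_of_pos_of_lt_pi h0 h1).ne'
  have h2 : AC ^ 2 = R ^ 2 * cos β ^ 2 * (1 + Real.cot γ' ^ 2) := by
    rw [hAC, Real.cot_eq_cos_div_sin]
    have := sin_sq_add_cos_sq γ'
    field_simp
    linarith
  rw [hR', h2, hcot]
  have h3 : cos γ ^ 2 = 1 - sin γ ^ 2 := by
    have := sin_sq_add_cos_sq γ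
    linarith
  field_simp
  linear_combination (cos β ^ 2 - 1) * h3
end

section
/- For every integer g ≥ 2, one has (cos α_g + cos β_g·cos γ_g)/(cos γ_g·√(cos²α_g + cos²β_g + cos²γ_g + 2·cos α_g·cos β_g·cos γ_g − 1)) = 2·cos α_g·√((4·cos²α_g − 1)/(4·cos⁴α_g − 1)). (This is Lemma 4.3: the left-hand side is the Euclidean length ℓ_g, on the boundary of the maximal horocusp section of M_g, of the geodesics representing the slope determined by the edges f₁,…,f_{g+1}; the right-hand side is its closed form.) -/
open Real

/-- Lemma 4.3: the Euclidean length `ℓ_g` of the slope determined by `f₁, …, f_{g+1}`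
on the maximal horocusp section of `M_g` has the stated closed form. -/
theorem slope_length (g : ℕ) (hg : 2 ≤ g) (α β γ : ℝ)
    (hα : α = π / (2 * (g : ℝ) + 2)) (hβ : β = 2 * α)
    (hγ : γ = arccos (1 / (2 * cos α))) :
    (cos α + cos β * cos γ) /
      (cos γ * Real.sqrt (cos α ^ 2 + cos β ^ 2 + cos γ ^ 2 +
        2 * cos α * cos β * cos γ - 1)) =
    2 * cos α * Real.sqrt ((4 * cos α ^ 2 - 1) / (4 * cos α ^ 4 - 1)) := by
  have hg' : (2 : ℝ) ≤ g := by exact_mod_cast hg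
  have hpi := Real.pi_pos
  have ha0 : 0 ≤ α := by rw [hα]; positivity
  have ha1 : α ≤ π / 6 := by
    rw [hα]
    exact div_le_div_of_nonneg_left hpi.le (by norm_num) (by linarith)
  have hc : √3 / 2 ≤ cos α := by
    rw [← Real.cos_pi_div_six]
    exact Real.cos_le_cos_of_nonneg_of_le_pi ha0 (by linarith) ha1
  have h3 : (0 : ℝ) < √3 := by positivity
  have h3' : √3 ^ 2 = (3 : ℝ) := Real.sq_sqrt (by norm_num)
  have hB : cos β = 2 * cos α ^ 2 - 1 := by rw [hβ, Real.cos_two_mul]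
  have hc0 : 0 < cos α := by linarith
  have hc2 : 3 / 4 ≤ cos α ^ 2 := by nlinarith
  have hch : 1 / 2 ≤ cos α := by nlinarith
  have hG : cos γ = 1 / (2 * cos α) := by
    rw [hγ]
    apply Real.cos_arccos
    · have : 0 < 1 / (2 * cos α) := by positivity
      linarith
    · rw [div_le_one (by positivity)]; linarith
  rw [hB, hG]
  generalize cos α = c at *
  have hA : 0 < 4 * c ^ 2 - 1 := by linarith
  have hD : 0 < 4 * c ^ 4 - 1 := by nlinarith
  have hR : c ^ 2 + (2 * c ^ 2 - 1) ^ 2 + (1 / (2 * c)) ^ 2 +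
      2 * c * (2 * c ^ 2 - 1) * (1 / (2 * c)) - 1
      = (4 * c ^ 2 - 1) * (4 * c ^ 4 - 1) / (2 * c) ^ 2 := by
    field_simp
    ring
  have hN : c + (2 * c ^ 2 - 1) * (1 / (2 * c)) = (4 * c ^ 2 - 1) / (2 * c) := by
    field_simp
    ring
  rw [hR, hN, Real.sqrt_div (by positivity), Real.sqrt_sq (by positivity),
    Real.sqrt_mul hA.le, Real.sqrt_div hA.le]
  have hsA := Real.sqrt_pos.mpr hA
  have hsD := Real.sqrt_pos.mpr hD
  have hsq := Real.sq_sqrt hA.le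
  generalize √(4 * c ^ 2 - 1) = a at *
  generalize √(4 * c ^ 4 - 1) = d at *
  rw [← hsq]
  field_simp
end

section
/- For all integers g ≥ 2 and n ≥ 1 with (g+1)·n ≥ 6, one has (g+1)·n·(4·cos²α_g − 1)/(cos α_g·√(4·cos⁴α_g − 1)) > 6. (This is the main estimate in the proof of Proposition 4.4: for a slope s at distance n from the special slope on the boundary torus of M_g, the Euclidean length of s on the maximal horocusp section is at least the left-hand side, so it exceeds 6.) -/
open Real

/-- The main estimate in Proposition 4.4: for integers `g ≥ 2` and `n ≥ 1` with
`(g+1)·n ≥ 6`, one has `(g+1)·n·(4 cos²α_g − 1)/(cos α_g·√(4 cos⁴α_g − 1)) > 6`. -/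
theorem length_estimate (g n : ℕ) (hg : 2 ≤ g) (hn : 1 ≤ n)
    (h : 6 ≤ (g + 1) * n) (α : ℝ) (hα : α = π / (2 * (g : ℝ) + 2)) :
    6 < ((g : ℝ) + 1) * (n : ℝ) * (4 * cos α ^ 2 - 1) /
      (cos α * Real.sqrt (4 * cos α ^ 4 - 1)) := by
  have hg' : (2 : ℝ) ≤ g := by exact_mod_cast hg
  have h' : (6 : ℝ) ≤ ((g : ℝ) + 1) * n := by exact_mod_cast h
  have hpi := Real.pi_pos
  have hα0 : 0 ≤ α := by rw [hα]; positivity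
  have hα6 : α ≤ π / 6 := by
    rw [hα]
    apply div_le_div_of_nonneg_left hpi.le (by norm_num) (by linarith)
  have hc : √3 / 2 ≤ cos α := by
    rw [← Real.cos_pi_div_six]
    exact Real.cos_le_cos_of_nonneg_of_le_pi hα0 (by linarith) hα6
  have h3 : 0 < √3 := by positivity
  have hs : √3 ^ 2 = 3 := Real.sq_sqrt (by norm_num)
  have hcpos : 0 < cos α := by linarith
  have hx : 3 / 4 ≤ cos α ^ 2 := by nlinarith
  have hx1 : cos α ^ 2 ≤ 1 := Real.cos_sq_le_one α
  have h4 : cos α ^ 4 = (cos α ^ 2) ^ 2 := by ring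
  have hr : 0 < 4 * cos α ^ 4 - 1 := by rw [h4]; nlinarith
  have hsr : 0 < √(4 * cos α ^ 4 - 1) := Real.sqrt_pos.mpr hr
  have key : cos α * √(4 * cos α ^ 4 - 1) < 4 * cos α ^ 2 - 1 := by
    apply lt_of_pow_lt_pow_left₀ 2 (by linarith)
    rw [mul_pow, Real.sq_sqrt hr.le, h4]
    generalize cos α ^ 2 = x at *
    nlinarith [mul_nonneg (sq_nonneg x) (sub_nonneg.mpr hx1)]
  rw [lt_div_iff₀ (by positivity)]
  calc 6 * (cos α * √(4 * cos α ^ 4 - 1)) < 6 * (4 * cos α ^ 2 - 1) := by linarith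
    _ ≤ _ := mul_le_mul_of_nonneg_right h' (by linarith)
end

section
/- For every integer g ≥ 2, let r and s be the permutations of the set (ZMod (2g+2)) ⊕ (Fin 2) defined by r(inl i) = inl(i+2), r(inr j) = inr j, s(inl i) = inl(−i), s(inr 0) = inr 1, s(inr 1) = inr 0. Then the subgroup of the permutation group of (ZMod (2g+2)) ⊕ (Fin 2) generated by r and s is isomorphic to the dihedral group D_{g+1} of order 2(g+1). (This is the combinatorial content of the computation of the isometry group Iso(M_g) ≅ D_{g+1}.) -/
/-- The subgroup of the permutation group of `ZMod (2g+2) ⊕ Fin 2` generated by the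
combinatorial automorphisms `r_g` and `s_g` of the double cone `P_{g+1}` is isomorphic
to the dihedral group `D_{g+1}` of order `2(g+1)`. -/
theorem automorphism_group_dihedral (g : ℕ) (hg : 2 ≤ g)
    (r s : Equiv.Perm (ZMod (2 * g + 2) ⊕ Fin 2))
    (hr₁ : ∀ i : ZMod (2 * g + 2), r (Sum.inl i) = Sum.inl (i + 2))
    (hr₂ : ∀ j : Fin 2, r (Sum.inr j) = Sum.inr j)
    (hs₁ : ∀ i : ZMod (2 * g + 2), s (Sum.inl i) = Sum.inl (-i))
    (hs₂ : s (Sum.inr 0) = Sum.inr 1)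
    (hs₃ : s (Sum.inr 1) = Sum.inr 0) :
    Nonempty ((Subgroup.closure {r, s} :
      Subgroup (Equiv.Perm (ZMod (2 * g + 2) ⊕ Fin 2))) ≃* DihedralGroup (g + 1)) := by
  have : NeZero (g + 1) := ⟨by omega⟩
  have hpl : ∀ (k : ℕ) (i : ZMod (2 * g + 2)),
      (r ^ k) (Sum.inl i) = Sum.inl (i + ((2 * k : ℕ) : ZMod (2 * g + 2))) := by
    intro k
    induction k with
    | zero => intro i; simp
    | succ k ih =>
      intro i
      rw [pow_succ, Equiv.Perm.mul_apply, hr₁, ih]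
      congr 1
      push_cast
      ring
  have hpr : ∀ (k : ℕ) (j : Fin 2), (r ^ k) (Sum.inr j) = Sum.inr j := by
    intro k
    induction k with
    | zero => intro i; simp
    | succ k ih =>
      intro i
      rw [pow_succ, Equiv.Perm.mul_apply, hr₂, ih]
  have hone : ∀ k : ℕ, r ^ k = 1 ↔ (g + 1) ∣ k := by
    intro k
    have key : ((2 * k : ℕ) : ZMod (2 * g + 2)) = 0 ↔ (g + 1) ∣ k := by
      rw [ZMod.natCast_eq_zero_iff, show 2 * g + 2 = 2 * (g + 1) by ring]
      exact Nat.mul_dvd_mul_iff_left (by norm_num)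
    rw [← key]
    constructor
    · intro h
      have h1 := hpl k 0
      rw [h] at h1
      simpa using h1.symm
    · intro h
      ext x
      rcases x with i | j
      · rw [hpl, h]; simp
      · rw [hpr]; simp
  have hord : orderOf r = g + 1 := by
    apply Nat.dvd_antisymm
    · exact orderOf_dvd_of_pow_eq_one ((hone _).2 dvd_rfl)
    · exact (hone _).1 (pow_orderOf_eq_one r)
  have hss : s * s = 1 := by
    ext x
    rcases x with i | j
    · simp [hs₁]
    · fin_cases j <;> simp [hs₂, hs₃]
  have hrsr : r * s * r = s := by
    ext x
    rcases x with i | j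
    · simp only [Equiv.Perm.mul_apply, hr₁, hs₁]
      congr 1
      ring
    · fin_cases j <;> simp [hs₂, hs₃, hr₂]
  have hsemi : SemiconjBy s r⁻¹ r := by
    show s * r⁻¹ = r * s
    rw [mul_inv_eq_iff_eq_mul, hrsr]
  let F : ZMod (g + 1) → Equiv.Perm (ZMod (2 * g + 2) ⊕ Fin 2) := fun i => r ^ i.val
  have hFadd : ∀ i j, F (i + j) = F i * F j := by
    intro i j
    show r ^ (i + j).val = r ^ i.val * r ^ j.val
    rw [ZMod.val_add, ← pow_add]
    have h := pow_mod_orderOf r (i.val + j.val)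
    rwa [hord] at h
  have hF0 : F 0 = 1 := by simp [F]
  have hFneg : ∀ i, F (-i) = (F i)⁻¹ := by
    intro i
    rw [eq_inv_iff_mul_eq_one, ← hFadd, neg_add_cancel, hF0]
  have hFs : ∀ i, F i * s = s * F (-i) := by
    intro i
    rw [hFneg]
    have h := (hsemi.pow_right i.val).eq
    rw [inv_pow] at h
    exact h.symm
  let φ : DihedralGroup (g + 1) →* Equiv.Perm (ZMod (2 * g + 2) ⊕ Fin 2) :=
    { toFun := fun x => match x with
        | DihedralGroup.r i => F i
        | DihedralGroup.sr i => s * F i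
      map_one' := hF0
      map_mul' := by
        rintro (i | i) (j | j)
        · exact hFadd i j
        · show s * F (j - i) = F i * (s * F j)
          rw [← mul_assoc, hFs, mul_assoc, ← hFadd, neg_add_eq_sub]
        · show s * F (i + j) = s * F i * F j
          rw [hFadd, mul_assoc]
        · show F (j - i) = s * F i * (s * F j)
          rw [mul_assoc, ← mul_assoc (F i), hFs, mul_assoc s, ← hFadd, ← mul_assoc, hss,
            one_mul, neg_add_eq_sub] }
  have hφr : ∀ i, φ (DihedralGroup.r i) = r ^ i.val := fun _ => rfl
  have hφs : ∀ i, φ (DihedralGroup.sr i) = s * r ^ i.val := fun _ => rfl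
  have hinj : Function.Injective φ := by
    rw [injective_iff_map_eq_one]
    rintro (i | i) h
    · rw [hφr, hone] at h
      have h0 := Nat.eq_zero_of_dvd_of_lt h (ZMod.val_lt i)
      rw [(ZMod.val_eq_zero i).1 h0, DihedralGroup.r_zero]
    · rw [hφs] at h
      have h1 := congrArg (fun p => p (Sum.inr 0)) h
      simp [hpr, hs₂] at h1
  have hrange : φ.range = Subgroup.closure {r, s} := by
    have hrm : r ∈ Subgroup.closure {r, s} := Subgroup.subset_closure (by simp)
    have hsm : s ∈ Subgroup.closure {r, s} := Subgroup.subset_closure (by simp)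
    apply le_antisymm
    · rintro _ ⟨(i | i), rfl⟩
      · rw [hφr]; exact pow_mem hrm _
      · rw [hφs]; exact mul_mem hsm (pow_mem hrm _)
    · rw [Subgroup.closure_le]
      rintro x (rfl | rfl)
      · refine ⟨DihedralGroup.r 1, ?_⟩
        rw [hφr, ZMod.val_one'' (by omega), pow_one]
      · refine ⟨DihedralGroup.sr 0, ?_⟩
        rw [hφs, ZMod.val_zero, pow_zero, mul_one]
  rw [← hrange]
  exact ⟨(MonoidHom.ofInjective hinj).symm⟩
end
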